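/- Let S and A be finite sets, V ∈ ℝ^{|S|}, c : A → ℝ, and for each a ∈ A let P^a be a nonempty compact subset of the probability simplex P^{|S|}. Then min over π in the probability simplex P^{|A|} of the max over choices (p^a)_{a∈A} with p^a ∈ P^a of [∑_{a∈A} π_a·c(a) + Φ(∑_{a∈A} π_a·p^a, V)] equals min_{a∈A} max_{p ∈ P^a} [c(a) + Φ(p, V)]. -/

import Mathlib

open Finset

/-- The probability simplex over a finite type `T`. -/
def Simplex (T : Type) [Fintype T] : Set (T → ℝ) :=
  {p | (∀ t, 0 ≤ p t ∧ p t ≤ 1) ∧ ∑ t, p t = 1}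

/-- `Φ(p,V) = -∑_q p_q log₂ p_q + ∑_q p_q V_q` (with `0·log₂ 0 = 0`,
which holds automatically since `Real.logb 2 0 = 0`). -/
noncomputable def Phi {S : Type} [Fintype S] (p V : S → ℝ) : ℝ :=
  (-∑ q, p q * Real.logb 2 (p q)) + ∑ q, p q * V q

theorem simplex_eq_stdSimplex (T : Type) [Fintype T] : Simplex T = stdSimplex ℝ T := by
  ext p
  refine ⟨fun h => ⟨fun t => (h.1 t).1, h.2⟩, fun h => ⟨fun t => ⟨h.1 t, ?_⟩, h.2⟩⟩
  exact h.2 ▸ single_le_sum (f := p) (fun i _ => h.1 i) (mem_univ t)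

section Phi

variable {S : Type} [Fintype S]

theorem Phi_eq_sum_negMulLog (p V : S → ℝ) :
    Phi p V = ∑ q, ((Real.log 2)⁻¹ * Real.negMulLog (p q) + p q * V q) := by
  rw [Phi, ← sum_neg_distrib, ← sum_add_distrib]
  refine sum_congr rfl fun q _ => ?_
  rw [Real.negMulLog, Real.logb]
  ring

theorem continuous_Phi (V : S → ℝ) : Continuous fun p => Phi p V := by
  simp only [Phi_eq_sum_negMulLog]
  have := Real.continuous_negMulLog
  fun_prop

theorem concaveOn_Phi (V : S → ℝ) : ConcaveOn ℝ (stdSimplex ℝ S) fun p => Phi p V := by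
  refine ⟨convex_stdSimplex ℝ S, fun x hx y hy a b ha hb hab => ?_⟩
  simp only [Phi_eq_sum_negMulLog, smul_eq_mul, mul_sum, ← sum_add_distrib]
  refine sum_le_sum fun q _ => ?_
  have h := mul_le_mul_of_nonneg_left
    (Real.concaveOn_negMulLog.2 (hx.1 q) (hy.1 q) ha hb hab)
    (inv_nonneg.2 (Real.log_nonneg one_le_two))
  simp only [smul_eq_mul, Pi.add_apply, Pi.smul_apply] at h ⊢
  linarith

theorem exists_forall_Phi_le (V : S → ℝ) : ∃ B, ∀ p ∈ stdSimplex ℝ S, Phi p V ≤ B := by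
  obtain ⟨B, hB⟩ := ((isCompact_stdSimplex ℝ S).image (continuous_Phi V)).bddAbove
  exact ⟨B, fun p hp => hB ⟨p, hp, rfl⟩⟩

end Phi

/-- for nonempty compact subsets `P^a` of the probability simplex,
the min over randomized action distributions `π ∈ P^{|A|}` of the max over feasible
choices `(p^a)_{a∈A}` of `∑_a π_a c(a) + Φ(∑_a π_a p^a, V)` equals the min over
single actions `min_{a∈A} max_{p ∈ P^a} [c(a) + Φ(p, V)]`. -/
theorem minmax_single_action_reduction
    {S A : Type} [Fintype S] [Fintype A] [Nonempty S] [Nonempty A]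
    (V : S → ℝ) (c : A → ℝ) (P : A → Set (S → ℝ))
    (hP : ∀ a, (P a).Nonempty ∧ IsCompact (P a) ∧ P a ⊆ Simplex S) :
    sInf {x | ∃ π ∈ Simplex A, x =
        sSup {y | ∃ pc : A → S → ℝ, (∀ a, pc a ∈ P a) ∧
          y = (∑ a, π a * c a) + Phi (fun q => ∑ a, π a * pc a q) V}}
      = ⨅ a : A, sSup {y | ∃ p ∈ P a, y = c a + Phi p V} := by
  classical
  simp only [simplex_eq_stdSimplex] at hP ⊢
  obtain ⟨B, hB⟩ := exists_forall_Phi_le V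
  set M : A → ℝ := fun a => sSup {y | ∃ p ∈ P a, y = c a + Phi p V} with hM
  have mix_eq (pc : A → S → ℝ) (π : A → ℝ) :
      (fun q => ∑ a, π a * pc a q) = ∑ a, π a • pc a := by
    ext q
    simp
  have lower : ∀ π ∈ stdSimplex ℝ A, ⨅ a, M a ≤
      sSup {y | ∃ pc : A → S → ℝ, (∀ a, pc a ∈ P a) ∧
        y = (∑ a, π a * c a) + Phi (fun q => ∑ a, π a * pc a q) V} := by
    intro π hπ
    have bdd : BddAbove {y | ∃ pc : A → S → ℝ, (∀ a, pc a ∈ P a) ∧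
        y = (∑ a, π a * c a) + Phi (fun q => ∑ a, π a * pc a q) V} := by
      refine ⟨(∑ a, π a * c a) + B, ?_⟩
      rintro _ ⟨pc, hpc, rfl⟩
      gcongr
      apply hB
      rw [mix_eq]
      exact (convex_stdSimplex ℝ S).sum_mem (fun a _ => hπ.1 a) hπ.2
        fun a _ => (hP a).2.2 (hpc a)
    refine le_of_forall_pos_sub_le fun ε hε => ?_
    have near (a : A) : ∃ p ∈ P a, M a - ε < c a + Phi p V := by
      obtain ⟨p, hp⟩ := (hP a).1
      obtain ⟨_, ⟨p, hp, rfl⟩, h⟩ := exists_lt_of_lt_csSup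
        (s := {y | ∃ p ∈ P a, y = c a + Phi p V}) ⟨_, p, hp, rfl⟩ (sub_lt_self (M a) hε)
      exact ⟨p, hp, h⟩
    choose pc hpc hlt using near
    refine le_csSup_of_le bdd ⟨pc, hpc, rfl⟩ ?_
    have concave := (concaveOn_Phi V).le_map_sum (t := univ) (w := π) (p := pc)
      (fun a _ => hπ.1 a) hπ.2 fun a _ => (hP a).2.2 (hpc a)
    calc (⨅ a, M a) - ε = ∑ a, π a * ((⨅ a, M a) - ε) := by rw [← sum_mul, hπ.2, one_mul]
      _ ≤ ∑ a, π a * (c a + Phi (pc a) V) := by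
        refine sum_le_sum fun a _ => mul_le_mul_of_nonneg_left ?_ (hπ.1 a)
        linarith [ciInf_le (Set.finite_range M).bddBelow a, hlt a]
      _ = (∑ a, π a * c a) + ∑ a, π a • Phi (pc a) V := by
        simp only [mul_add, sum_add_distrib, smul_eq_mul]
      _ ≤ _ := by
        rw [mix_eq]
        gcongr
  have pure_eq (a : A) : M a = sSup {y | ∃ pc : A → S → ℝ, (∀ b, pc b ∈ P b) ∧
      y = (∑ b, (Pi.single a 1 : A → ℝ) b * c b) +
        Phi (fun q => ∑ b, (Pi.single a 1 : A → ℝ) b * pc b q) V} := by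
    simp only [hM, Pi.single_apply, ite_mul, one_mul, zero_mul, sum_ite_eq', mem_univ, if_true]
    congr 1
    ext y
    constructor
    · rintro ⟨p, hp, rfl⟩
      choose p₀ hp₀ using fun b => (hP b).1
      refine ⟨Function.update p₀ a p, fun b => ?_, by simp⟩
      obtain rfl | h := eq_or_ne b a
      · simpa using hp
      · simpa [h] using hp₀ b
    · rintro ⟨pc, hpc, rfl⟩
      exact ⟨pc a, hpc a, rfl⟩
  apply le_antisymm
  · refine le_ciInf fun a => csInf_le ⟨⨅ a, M a, ?_⟩
      ⟨Pi.single a 1, single_mem_stdSimplex ℝ a, pure_eq a⟩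
    rintro _ ⟨π, hπ, rfl⟩
    exact lower π hπ
  · obtain ⟨a⟩ := ‹Nonempty A›
    refine le_csInf ⟨M a, Pi.single a 1, single_mem_stdSimplex ℝ a, pure_eq a⟩ ?_
    rintro _ ⟨π, hπ, rfl⟩
    exact lower π hπ
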